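/- The group of ℚ-rational points of the elliptic curve E : Y² = X³ − 17X² + 72X is isomorphic as an abelian group to ℤ/2ℤ ⊕ ℤ/4ℤ. -/

import Mathlib

/-- The elliptic curve `E : Y² = X³ − 17X² + 72X = X(X−8)(X−9)` over `ℚ`. -/
def E : WeierstrassCurve ℚ := ⟨0, -17, 0, 72, 0⟩

/-- Two integers whose product is a square have the same squarefree part. -/
theorem exists_eq_mul_sq_of_mul_eq_sq {A B z : ℤ} (h : A * B = z ^ 2) (h0 : A ≠ 0) :
    ∃ d a b : ℤ, A = d * a ^ 2 ∧ B = d * b ^ 2 := by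
  have hg : 0 < Int.gcd A B := Int.gcd_pos_of_ne_zero_left _ h0
  obtain ⟨A', B', hco, hA, hB⟩ := Int.exists_gcd_one hg
  set g : ℤ := (Int.gcd A B : ℤ) with hgdef
  have hg0 : g ≠ 0 := by positivity
  have hco' : IsCoprime A' B' := Int.isCoprime_iff_gcd_eq_one.mpr hco
  have hz : g ∣ z := by
    rw [← Int.pow_dvd_pow_iff two_ne_zero]
    exact ⟨A' * B', by rw [← h, hA, hB]; ring⟩
  obtain ⟨w, rfl⟩ := hz
  have hw : A' * B' = w ^ 2 := by
    have : g ^ 2 * (A' * B') = g ^ 2 * w ^ 2 := by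
      rw [← mul_pow, ← h, hA, hB]; ring
    exact mul_left_cancel₀ (pow_ne_zero 2 hg0) this
  obtain ⟨a, ha⟩ := Int.sq_of_isCoprime hco' hw
  obtain ⟨b, hb⟩ := Int.sq_of_isCoprime hco'.symm (by rw [mul_comm]; exact hw)
  have ha0 : A' ≠ 0 := by
    rintro rfl
    simp at hA
    exact h0 hA
  have ha2 : 0 < a ^ 2 := by
    have : a ≠ 0 := by rintro rfl; simp at ha; exact ha0 ha
    positivity
  have hb2 := sq_nonneg b
  have hw2 := sq_nonneg w
  rcases ha with ha | ha <;> rcases hb with hb | hb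
  · exact ⟨g, a, b, by rw [hA, ha]; ring, by rw [hB, hb]; ring⟩
  · have : b ^ 2 = 0 := by rw [ha, hb] at hw; nlinarith
    exact ⟨g, a, b, by rw [hA, ha]; ring, by rw [hB, hb, this]; ring⟩
  · have : b ^ 2 = 0 := by rw [ha, hb] at hw; nlinarith
    exact ⟨-g, a, b, by rw [hA, ha]; ring, by rw [hB, hb, this]; ring⟩
  · exact ⟨-g, a, b, by rw [hA, ha]; ring, by rw [hB, hb]; ring⟩

theorem exists_sq_of_coprime_of_nonneg {u v y : ℤ} (hco : IsCoprime u v) (hu : 0 ≤ u)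
    (h : u * v = y ^ 2) : ∃ p, u = p ^ 2 := by
  obtain ⟨p, hp | hp⟩ := Int.sq_of_isCoprime hco h
  · exact ⟨p, hp⟩
  · exact ⟨0, by nlinarith [sq_nonneg p]⟩

/-- Coprime nonnegative integers whose product is a prime times a square. -/
theorem exists_sq_of_mul_eq_prime_mul_sq {c u v y : ℤ} (hc : Prime c) (hc0 : 0 < c)
    (hco : IsCoprime u v) (hu : 0 ≤ u) (hv : 0 ≤ v) (h : u * v = c * y ^ 2) :
    ∃ p q : ℤ, y ^ 2 = (p * q) ^ 2 ∧ ((u = c * p ^ 2 ∧ v = q ^ 2) ∨ (u = q ^ 2 ∧ v = c * p ^ 2)) := by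
  have key : ∀ {u v : ℤ}, IsCoprime u v → 0 ≤ u → 0 ≤ v → u * v = c * y ^ 2 → c ∣ u →
      ∃ p q : ℤ, y ^ 2 = (p * q) ^ 2 ∧ u = c * p ^ 2 ∧ v = q ^ 2 := by
    rintro _ v hco hu hv h ⟨u, rfl⟩
    have hco' : IsCoprime u v := hco.of_mul_left_right
    have h' : u * v = y ^ 2 := mul_left_cancel₀ hc0.ne' (by rw [← h]; ring)
    obtain ⟨p, rfl⟩ := exists_sq_of_coprime_of_nonneg hco' (nonneg_of_mul_nonneg_right hu hc0) h'
    obtain ⟨q, rfl⟩ := exists_sq_of_coprime_of_nonneg hco'.symm hv (by rw [mul_comm]; exact h')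
    exact ⟨p, q, by rw [← h']; ring, rfl, rfl⟩
  rcases hc.dvd_or_dvd (Dvd.intro _ h.symm) with hd | hd
  · obtain ⟨p, q, h1, h2, h3⟩ := key hco hu hv h hd
    exact ⟨p, q, h1, .inl ⟨h2, h3⟩⟩
  · obtain ⟨p, q, h1, h2, h3⟩ := key hco.symm hv hu (by rw [mul_comm]; exact h) hd
    exact ⟨p, q, h1, .inr ⟨h3, h2⟩⟩

theorem dvd_of_dvd_mul_of_isCoprime {n k x y : ℤ} (hco : IsCoprime x y) (hx : n ∣ k * x)
    (hy : n ∣ k * y) : n ∣ k := by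
  obtain ⟨s, t, hst⟩ := hco
  have : k = s * (k * x) + t * (k * y) := by linear_combination -k * hst
  rw [this]
  exact dvd_add (hx.mul_left _) (hy.mul_left _)

theorem isCoprime_of_forall_isUnit {e q : ℤ} (h : ∀ n : ℤ, n ∣ e → n ∣ q → IsUnit n) : IsCoprime e q := by
  rw [Int.isCoprime_iff_gcd_eq_one]
  have := h _ (Int.gcd_dvd_left e q) (Int.gcd_dvd_right e q)
  simpa [Int.isUnit_iff] using this

/-- The half-sum and half-difference of coprime odd integers are coprime. -/
theorem exists_half_sum {e q : ℤ} (hco : IsCoprime e q) (he : Odd e) (hq : Odd q) :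
    ∃ u v : ℤ, IsCoprime u v ∧ e = v + u ∧ q = v - u := by
  obtain ⟨i, hi⟩ := he
  obtain ⟨j, hj⟩ := hq
  refine ⟨i - j, i + j + 1, ?_, by omega, by omega⟩
  obtain ⟨s, t, hst⟩ := hco
  exact ⟨s - t, s + t, by linear_combination hst - s * hi - t * hj⟩

theorem sq_mod_cases (x : ℤ) : (Even x ∧ ∃ k, x ^ 2 = 4 * k) ∨ (Odd x ∧ ∃ k, x ^ 2 = 8 * k + 1) := by
  rcases Int.even_or_odd x with h | h
  · obtain ⟨i, rfl⟩ := h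
    exact .inl ⟨⟨i, rfl⟩, i ^ 2, by ring⟩
  · refine .inr ⟨h, ?_⟩
    obtain ⟨k, hk⟩ := Int.eight_dvd_sq_sub_one_of_odd h
    exact ⟨k, by linarith⟩

theorem not_even_and_even {x y : ℤ} (hco : IsCoprime x y) (hx : Even x) (hy : Even y) : False := by
  have := hco.isUnit_of_dvd' hx.two_dvd hy.two_dvd
  norm_num [Int.isUnit_iff] at this

theorem isUnit_of_sq_dvd_of_squarefree {n m : ℤ} (hm : Squarefree m) (h : n ^ 2 ∣ m) : IsUnit n :=
  hm n (by rwa [← sq])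

/-- The solutions of `b² - a² = e²`, `b² - 4a² = q²` in coprime integers with `q` odd. -/
theorem exists_of_sq_sub_sq {a b e q : ℤ} (hco : IsCoprime a b) (hq : Odd q)
    (h1 : b ^ 2 - a ^ 2 = e ^ 2) (h2 : b ^ 2 - 4 * a ^ 2 = q ^ 2) :
    ∃ g h : ℤ, IsCoprime h g ∧ a ^ 2 = 4 * g ^ 2 * h ^ 2 ∧
      b ^ 2 = (h ^ 2 + g ^ 2) * (h ^ 2 + 9 * g ^ 2) ∧ e ^ 2 = (h ^ 2 + 3 * g ^ 2) ^ 2 := by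
  wlog he0 : 0 ≤ e generalizing e
  · obtain ⟨g, h, H⟩ := this (e := -e) (by rw [h1]; ring) (by linarith)
    exact ⟨g, h, by simpa using H⟩
  wlog hq0 : 0 ≤ q generalizing q
  · exact this (q := -q) hq.neg (by rw [h2]; ring) (by linarith)
  have hae : Even a ∧ Odd e := by
    rcases sq_mod_cases a with ⟨pa, i, hi⟩ | ⟨pa, i, hi⟩ <;>
    rcases sq_mod_cases b with ⟨pb, j, hj⟩ | ⟨pb, j, hj⟩ <;>
    rcases sq_mod_cases e with ⟨pe, k, hk⟩ | ⟨pe, k, hk⟩ <;>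
    rcases sq_mod_cases q with ⟨pq, l, hl⟩ | ⟨pq, l, hl⟩ <;>
    first | exact ⟨pa, pe⟩ | (exfalso; omega) | exact absurd hq (Int.not_odd_iff_even.mpr pq)
  obtain ⟨⟨f, rfl⟩, he⟩ := hae
  have hcoe : IsCoprime e q := by
    refine isCoprime_of_forall_isUnit fun n hn1 hn2 => ?_
    have d1 := pow_dvd_pow_of_dvd hn1 2
    have d2 := pow_dvd_pow_of_dvd hn2 2
    refine isUnit_of_sq_dvd_of_squarefree (m := 3) Int.prime_three.squarefree ?_
    refine dvd_of_dvd_mul_of_isCoprime (hco.pow (m := 2) (n := 2)) ?_ ?_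
    · rw [show 3 * (f + f) ^ 2 = e ^ 2 - q ^ 2 by rw [← h1, ← h2]; ring]
      exact dvd_sub d1 d2
    · rw [show 3 * b ^ 2 = 4 * e ^ 2 - q ^ 2 by rw [← h1, ← h2]; ring]
      exact dvd_sub (d1.mul_left _) d2
  obtain ⟨u, v, huv, rfl, rfl⟩ := exists_half_sum hcoe he hq
  have hmul : u * v = 3 * f ^ 2 := by linarith
  have hle : 0 ≤ u * v := by rw [hmul]; positivity
  have hu : 0 ≤ u := by
    by_contra! hneg
    nlinarith
  have hv : 0 ≤ v := by linarith
  obtain ⟨g, h, hf, H⟩ := exists_sq_of_mul_eq_prime_mul_sq Int.prime_three (by norm_num) huv hu hv hmul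
  have hb : b ^ 2 = (v + u) ^ 2 + 4 * f ^ 2 := by rw [← h1]; ring
  rcases H with ⟨rfl, rfl⟩ | ⟨rfl, rfl⟩
  · refine ⟨g, h, ?_, by linear_combination 4 * hf, by rw [hb, hf]; ring, by ring⟩
    exact ((IsCoprime.pow_iff two_pos two_pos).mp huv.of_mul_left_right).symm
  · refine ⟨g, h, ?_, by linear_combination 4 * hf, by rw [hb, hf]; ring, by ring⟩
    exact (IsCoprime.pow_iff two_pos two_pos).mp huv.of_mul_right_right

/-- A solution of the first quartic with `x ≠ 0 ≠ y` yields one of its `2`-isogenous quartic. -/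
theorem exists_of_add_sq_mul {x y z : ℤ} (hco : IsCoprime x y) (hy : y ≠ 0)
    (h : (x ^ 2 + y ^ 2) * (x ^ 2 + 9 * y ^ 2) = z ^ 2) :
    ∃ e q : ℤ, IsCoprime e q ∧ Odd q ∧ y ^ 2 = e ^ 2 * q ^ 2 ∧
      x ^ 2 = (q ^ 2 - e ^ 2) * (q ^ 2 - 4 * e ^ 2) := by
  have hy2 : 0 < y ^ 2 := by positivity
  have hA : 0 < x ^ 2 + y ^ 2 := by positivity
  have hco2 := hco.pow (m := 2) (n := 2)
  obtain ⟨d, a, b, ha, hb⟩ := exists_eq_mul_sq_of_mul_eq_sq h hA.ne'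
  have hd0 : 0 < d := by
    by_contra! hneg
    nlinarith [sq_nonneg a]
  have hd8 : d ∣ 8 := by
    refine dvd_of_dvd_mul_of_isCoprime hco2 ?_ ?_
    · exact ⟨9 * a ^ 2 - b ^ 2, by linear_combination 9 * ha - hb⟩
    · exact ⟨b ^ 2 - a ^ 2, by linear_combination hb - ha⟩
  have hd : d = 1 ∧ Odd a ∧ Odd b := by
    have hle := Int.le_of_dvd (by norm_num) hd8
    have hne := not_even_and_even hco
    rcases sq_mod_cases x with ⟨px, i, hi⟩ | ⟨px, i, hi⟩ <;>
    rcases sq_mod_cases y with ⟨py, j, hj⟩ | ⟨py, j, hj⟩ <;>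
    first
    | exact (hne px py).elim
    | (rcases sq_mod_cases a with ⟨pa, k, hk⟩ | ⟨pa, k, hk⟩ <;>
       rcases sq_mod_cases b with ⟨pb, l, hl⟩ | ⟨pb, l, hl⟩ <;>
       rw [hk] at ha <;> rw [hl] at hb <;> interval_cases d <;>
       first | exact ⟨rfl, pa, pb⟩ | (exfalso; omega))
  obtain ⟨rfl, hoa, hob⟩ := hd
  rw [one_mul] at ha hb
  wlog ha0 : 0 ≤ a generalizing a
  · exact this (-a) (by rw [ha]; ring) hoa.neg (by linarith)
  wlog hb0 : 0 ≤ b generalizing b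
  · exact this (-b) (by rw [hb]; ring) hob.neg (by linarith)
  have hcoab : IsCoprime b a := by
    refine isCoprime_of_forall_isUnit fun n hn1 hn2 => ?_
    have d1 := pow_dvd_pow_of_dvd hn1 2
    have d2 := pow_dvd_pow_of_dvd hn2 2
    have h8 : n ^ 2 ∣ 8 := by
      refine dvd_of_dvd_mul_of_isCoprime hco2 ?_ ?_
      · rw [show 8 * x ^ 2 = 9 * a ^ 2 - b ^ 2 by rw [← ha, ← hb]; ring]
        exact dvd_sub (d2.mul_left _) d1
      · rw [show 8 * y ^ 2 = b ^ 2 - a ^ 2 by rw [← ha, ← hb]; ring]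
        exact dvd_sub d1 d2
    have : IsCoprime (n ^ 2) (2 ^ 3) :=
      ((Int.isCoprime_two_right.mpr hoa.pow).of_isCoprime_of_dvd_left d2).pow_right
    exact (isUnit_pow_iff two_ne_zero).mp (this.isUnit_of_dvd' dvd_rfl (by simpa using h8))
  obtain ⟨u, v, huv, rfl, rfl⟩ := exists_half_sum hcoab hob hoa
  have hmul : u * v = 2 * y ^ 2 := by linarith
  have hu : 0 ≤ u := by
    by_contra! hneg
    nlinarith
  have hv : 0 ≤ v := by linarith
  obtain ⟨e, q, hf, H⟩ := exists_sq_of_mul_eq_prime_mul_sq Int.prime_two (by norm_num) huv hu hv hmul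
  rw [mul_pow] at hf
  rcases H with ⟨rfl, rfl⟩ | ⟨rfl, rfl⟩
  · refine ⟨e, q, ?_, ?_, hf, by linear_combination ha - hf⟩
    · exact (IsCoprime.pow_iff two_pos two_pos).mp huv.of_mul_left_right
    · exact (Int.odd_pow' two_ne_zero).mp (Int.isCoprime_two_left.mp huv.of_mul_left_left)
  · refine ⟨e, q, ?_, ?_, hf, by linear_combination ha - hf⟩
    · exact ((IsCoprime.pow_iff two_pos two_pos).mp huv.of_mul_right_right).symm
    · exact (Int.odd_pow' two_ne_zero).mp (Int.isCoprime_two_left.mp huv.symm.of_mul_left_left)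

/-- The second quartic splits into two squares in one of two ways. -/
theorem sub_sq_cases {e q x : ℤ} (hco : IsCoprime e q) (hq : Odd q) (hx : x ≠ 0)
    (h : x ^ 2 = (q ^ 2 - e ^ 2) * (q ^ 2 - 4 * e ^ 2)) :
    ∃ a b : ℤ, (q ^ 2 - e ^ 2 = a ^ 2 ∧ q ^ 2 - 4 * e ^ 2 = b ^ 2) ∨
      (b ^ 2 - a ^ 2 = e ^ 2 ∧ b ^ 2 - 4 * a ^ 2 = q ^ 2) := by
  have hco2 := hco.pow (m := 2) (n := 2)
  obtain ⟨d, a, b, ha, hb⟩ := exists_eq_mul_sq_of_mul_eq_sq h.symm (by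
    intro h0
    rw [h0, zero_mul] at h
    exact hx (pow_eq_zero_iff two_ne_zero |>.mp h))
  have hd3 : d ∣ 3 := by
    refine dvd_of_dvd_mul_of_isCoprime hco2 ?_ ?_
    · exact ⟨a ^ 2 - b ^ 2, by linear_combination ha - hb⟩
    · exact ⟨4 * a ^ 2 - b ^ 2, by linear_combination 4 * ha - hb⟩
  have hle := Int.le_of_dvd (by norm_num) hd3
  have hge := Int.le_of_dvd (by norm_num) (neg_dvd.mpr hd3)
  refine ⟨a, b, ?_⟩
  have hd : d = 1 ∨ d = -3 := by
    rcases sq_mod_cases q with ⟨pq, i, hi⟩ | ⟨pq, i, hi⟩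
    · exact absurd hq (Int.not_odd_iff_even.mpr pq)
    rcases sq_mod_cases e with ⟨pe, j, hj⟩ | ⟨pe, j, hj⟩ <;>
    rcases sq_mod_cases a with ⟨pa, k, hk⟩ | ⟨pa, k, hk⟩ <;>
    rcases sq_mod_cases b with ⟨pb, l, hl⟩ | ⟨pb, l, hl⟩ <;>
    rw [hk] at ha <;> rw [hl] at hb <;>
    have h1 : -3 ≤ d := (by linarith) <;>
    clear hge <;> interval_cases d <;> omega
  rcases hd with rfl | rfl
  · exact .inl ⟨by linarith, by linarith⟩
  · exact .inr ⟨by linarith, by linarith⟩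

theorem eq_zero_or_eq_zero_of_add_sq_mul {x y z : ℤ} (hco : IsCoprime x y)
    (h : (x ^ 2 + y ^ 2) * (x ^ 2 + 9 * y ^ 2) = z ^ 2) : x = 0 ∨ y = 0 := by
  induction hn : y.natAbs using Nat.strong_induction_on generalizing x y z with
  | _ n ih =>
  by_contra! hxy
  obtain ⟨hx, hy⟩ := hxy
  obtain ⟨e, q, heq, hq, hyeq, hxeq⟩ := exists_of_add_sq_mul hco hy h
  have hy2 : 0 < y ^ 2 := by positivity
  have hx2 : 0 < x ^ 2 := by positivity
  have he : 0 < e ^ 2 := by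
    have : e ≠ 0 := by rintro rfl; simp at hyeq; exact hy hyeq
    positivity
  have hq0 : 0 < q ^ 2 := by
    have : q ≠ 0 := by rintro rfl; simp at hq
    positivity
  have hlt : ∀ g : ℤ, g ^ 2 < y ^ 2 → g.natAbs < n := by
    intro g hg
    rw [← hn]
    exact Int.natAbs_lt_iff_sq_lt.mpr hg
  obtain ⟨a, b, ⟨h1, h2⟩ | ⟨h1, h2⟩⟩ := sub_sq_cases heq hq hx hxeq
  · have hob : Odd b := by
      have : Odd (b ^ 2) := by
        rw [← h2]
        exact hq.pow.sub_even ⟨2 * e ^ 2, by ring⟩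
      exact (Int.odd_pow' two_ne_zero).mp this
    obtain ⟨g, k, hgk, ha, hb, -⟩ := exists_of_sq_sub_sq heq hob h1 h2
    have hg : g ≠ 0 := by rintro rfl; simp at ha; simp [ha] at he
    have hk : k ≠ 0 := by rintro rfl; simp at ha; simp [ha] at he
    have hg2 : 0 < g ^ 2 := by positivity
    have hk2 : 0 < k ^ 2 := by positivity
    rcases ih _ (hlt g (by rw [hyeq, ha]; nlinarith [mul_pos hk2 hq0])) hgk hb.symm rfl with h0 | h0
    · exact hk h0
    · exact hg h0
  · have hco' : IsCoprime a b := by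
      refine isCoprime_of_forall_isUnit fun n hn1 hn2 => ?_
      have d1 := pow_dvd_pow_of_dvd hn1 2
      have d2 := pow_dvd_pow_of_dvd hn2 2
      have := (heq.pow (m := 2) (n := 2)).isUnit_of_dvd' (a := e ^ 2) (b := q ^ 2) (x := n ^ 2)
        (by rw [← h1]; exact dvd_sub d2 d1) (by rw [← h2]; exact dvd_sub d2 (d1.mul_left _))
      exact (isUnit_pow_iff two_ne_zero).mp this
    obtain ⟨g, k, hgk, ha, hb, he'⟩ := exists_of_sq_sub_sq hco' hq h1 h2
    have hlt' : g ^ 2 < y ^ 2 := by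
      rw [hyeq, he']
      rw [he'] at he
      have : 0 ≤ k ^ 2 := sq_nonneg k
      have : 0 ≤ g ^ 2 := sq_nonneg g
      have : 0 < k ^ 2 + 3 * g ^ 2 := by nlinarith
      nlinarith
    have ha0 : a = 0 := by
      rcases ih _ (hlt g hlt') hgk hb.symm rfl with rfl | rfl <;> simpa using ha
    rw [hxeq, ← h1, ← h2, ha0] at hx2
    simp at hx2

theorem eq_zero_of_add_one_mul {s w : ℚ} (h : (s ^ 2 + 1) * (s ^ 2 + 9) = w ^ 2) : s = 0 := by
  have hd : (s.den : ℚ) ≠ 0 := by exact_mod_cast s.den_ne_zero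
  have hs : s = s.num / s.den := s.num_div_den.symm
  have hsq : IsSquare ((((s.num ^ 2 + s.den ^ 2) * (s.num ^ 2 + 9 * s.den ^ 2) : ℤ)) : ℚ) := by
    refine ⟨w * s.den ^ 2, ?_⟩
    rw [hs] at h
    field_simp at h
    push_cast
    linear_combination h
  obtain ⟨z, hz⟩ := Rat.isSquare_intCast_iff.mp hsq
  rcases eq_zero_or_eq_zero_of_add_sq_mul s.isCoprime_num_den (by rw [hz, sq]) with h0 | h0
  · exact Rat.num_eq_zero.mp h0
  · exact absurd (by exact_mod_cast h0) hd

theorem exists_squarefree_mul_sq (n : ℤ) : ∃ d t : ℤ, Squarefree d ∧ n = d * t ^ 2 := by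
  obtain ⟨a, b, hab, ha⟩ := Nat.sq_mul_squarefree n.natAbs
  have ha' : Squarefree (a : ℤ) := Int.squarefree_natCast.mpr ha
  rcases Int.natAbs_eq n with h | h
  · exact ⟨a, b, ha', by rw [h, ← hab]; push_cast; ring⟩
  · exact ⟨-a, b, by simpa [← Int.squarefree_natAbs] using ha, by rw [h, ← hab]; push_cast; ring⟩

theorem eq_of_squarefree_of_dvd_nine {d : ℤ} (hd : Squarefree d) (h : d ∣ 9) :
    d = 1 ∨ d = -1 ∨ d = 3 ∨ d = -3 := by
  have h3 : d ∣ 3 := (hd.dvd_pow_iff_dvd two_ne_zero).mp (by simpa using h)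
  have hle := Int.le_of_dvd (by norm_num) h3
  have hge := Int.le_of_dvd (by norm_num) (neg_dvd.mpr h3)
  have : -3 ≤ d := by linarith
  clear hge
  obtain ⟨c, hc⟩ := h3
  interval_cases d <;> omega

theorem exists_eq_mul_sq_of_equation {x y : ℚ} (hx : x ≠ 0) (h : x * (x + 1) * (x + 9) = y ^ 2) :
    ∃ s : ℚ, s ≠ 0 ∧ (x = s ^ 2 ∨ x = -s ^ 2 ∨ x = 3 * s ^ 2 ∨ x = -3 * s ^ 2) := by
  obtain ⟨d, t, hd, ht⟩ := exists_squarefree_mul_sq (x.num * x.den)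
  have hd0 : d ≠ 0 := hd.ne_zero
  have hk : (x.den : ℚ) ≠ 0 := by exact_mod_cast x.den_ne_zero
  have hxs : x = x.num / x.den := x.num_div_den.symm
  have hco := x.isCoprime_num_den
  set m := x.num
  set k : ℤ := (x.den : ℤ) with hkdef
  have hk' : (k : ℚ) = x.den := by simp [hkdef]
  rw [← hk'] at hk hxs
  set w := m ^ 2 + 10 * m * k + 9 * k ^ 2 with hw
  have hsq : IsSquare (((m * k * w : ℤ)) : ℚ) := by
    refine ⟨y * k ^ 2, ?_⟩
    rw [hxs] at h
    field_simp at h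
    push_cast [hw]
    linear_combination (k : ℚ) * h
  obtain ⟨N, hN⟩ := Rat.isSquare_intCast_iff.mp hsq
  rw [ht] at hN
  have hx' : x = d * (t / k : ℚ) ^ 2 := by
    have : (m * k : ℚ) = d * t ^ 2 := by exact_mod_cast ht
    rw [hxs]
    field_simp
    linear_combination this
  have hs0 : (t / k : ℚ) ≠ 0 := by
    intro h0
    rw [h0] at hx'
    exact hx (by simpa using hx')
  have ht0 : t ≠ 0 := by rintro rfl; simp at hs0
  have hdw : d ∣ w := by
    have htN : t ∣ N := by
      rw [← Int.pow_dvd_pow_iff two_ne_zero]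
      exact ⟨d * w, by linear_combination -hN⟩
    obtain ⟨M, rfl⟩ := htN
    have hM : d * w = M ^ 2 := by
      have : t ^ 2 * (d * w) = t ^ 2 * M ^ 2 := by linear_combination hN
      exact mul_left_cancel₀ (pow_ne_zero 2 ht0) this
    obtain ⟨c, rfl⟩ := (hd.dvd_pow_iff_dvd two_ne_zero).mp (Dvd.intro _ hM)
    exact ⟨c ^ 2, mul_left_cancel₀ hd0 (by rw [hM]; ring)⟩
  have hdmk : d ∣ m * k := ⟨t ^ 2, ht⟩
  have hd9 : d ∣ 9 := by
    refine dvd_of_dvd_mul_of_isCoprime (hco.pow (m := 3) (n := 3)) ?_ ?_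
    · rw [show 9 * m ^ 3 = 9 * m * w - (90 * m + 81 * k) * (m * k) by rw [hw]; ring]
      exact dvd_sub (hdw.mul_left _) (hdmk.mul_left _)
    · rw [show 9 * k ^ 3 = k * w - (m + 10 * k) * (m * k) by rw [hw]; ring]
      exact dvd_sub (hdw.mul_left _) (hdmk.mul_left _)
  refine ⟨t / k, hs0, ?_⟩
  rcases eq_of_squarefree_of_dvd_nine hd hd9 with rfl | rfl | rfl | rfl
  · exact .inl (by simpa using hx')
  · exact .inr (.inl (by simpa using hx'))
  · exact .inr (.inr (.inl (by simpa using hx')))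
  · exact .inr (.inr (.inr (by simpa using hx')))

/-- The rational points of `y² = x(x+1)(x+9)`. -/
theorem x_eq_of_equation {x y : ℚ} (h : x * (x + 1) * (x + 9) = y ^ 2) :
    x = 0 ∨ x = -1 ∨ x = -9 ∨ x = 3 ∨ x = -3 := by
  by_contra! hne
  obtain ⟨h0, h1, h9, h3, h3'⟩ := hne
  obtain ⟨s, hs, H⟩ := exists_eq_mul_sq_of_equation h0 h
  have h1' : x + 1 ≠ 0 := fun h => h1 (by linarith)
  have h9' : x + 9 ≠ 0 := fun h => h9 (by linarith)
  have h3m : x - 3 ≠ 0 := fun h => h3 (by linarith)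
  have h3p : x + 3 ≠ 0 := fun h => h3' (by linarith)
  have hy : y ≠ 0 := by
    rintro rfl
    have : x * (x + 1) * (x + 9) ≠ 0 := by positivity
    exact this (by rw [h]; ring)
  -- Otherwise translating by a point with the same class as `x` reduces to the case `x = s ^ 2`.
  rcases H with hx | hx | hx | hx
  · refine hs (eq_zero_of_add_one_mul (s := s) (w := y / s) ?_)
    rw [div_pow, eq_div_iff (by positivity), ← h, hx]
    ring
  · subst hx
    have key := eq_zero_of_add_one_mul (s := y / (s * ((-s ^ 2) + 1))) (w := 8 * s / ((-s ^ 2) + 1)) (by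
      field_simp
      clear h0 h1 h9 h3 h3' h1' h9' h3m h3p hy hs
      grind)
    have : s * ((-s ^ 2) + 1) ≠ 0 := mul_ne_zero hs h1'
    exact hy ((div_eq_zero_iff.mp key).resolve_right this)
  · subst hx
    have key := eq_zero_of_add_one_mul (s := (4 * (3 * s ^ 2) - y) / (s * ((3 * s ^ 2) - 3)))
      (w := (y - 12) / ((3 * s ^ 2) - 3) * ((4 * (3 * s ^ 2) - y) / (s * ((3 * s ^ 2) - 3))) + 3 * s) (by
      field_simp
      clear h0 h1 h9 h3 h3' h1' h9' h3m h3p hy hs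
      grind)
    have : s * ((3 * s ^ 2) - 3) ≠ 0 := mul_ne_zero hs h3m
    have hy4 : y = 4 * (3 * s ^ 2) := by linarith [(div_eq_zero_iff.mp key).resolve_right this]
    have : (3 * s ^ 2) * ((3 * s ^ 2) - 3) ^ 2 = 0 := by rw [hy4] at h; linear_combination h
    exact mul_ne_zero h0 (pow_ne_zero 2 h3m) this
  · subst hx
    have key := eq_zero_of_add_one_mul (s := (y + 2 * (-3 * s ^ 2)) / (s * ((-3 * s ^ 2) + 3)))
      (w := (y - 6) / ((-3 * s ^ 2) + 3) * ((y + 2 * (-3 * s ^ 2)) / (s * ((-3 * s ^ 2) + 3))) + 3 * s) (by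
      field_simp
      clear h0 h1 h9 h3 h3' h1' h9' h3m h3p hy hs
      grind)
    have : s * ((-3 * s ^ 2) + 3) ≠ 0 := mul_ne_zero hs h3p
    have hy2 : y = -2 * (-3 * s ^ 2) := by linarith [(div_eq_zero_iff.mp key).resolve_right this]
    have : (-3 * s ^ 2) * ((-3 * s ^ 2) + 3) ^ 2 = 0 := by rw [hy2] at h; linear_combination h
    exact mul_ne_zero h0 (pow_ne_zero 2 h3p) this

namespace E

open WeierstrassCurve.Affine

theorem nonsingular_iff_equation {x y : ℚ} :
    E.toAffine.Nonsingular x y ↔ y ^ 2 = x * (x - 8) * (x - 9) := by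
  rw [← WeierstrassCurve.Affine.equation_iff_nonsingular_of_Δ_ne_zero,
    WeierstrassCurve.Affine.equation_iff]
  · simp only [E]
    constructor <;> intro h <;> linear_combination h
  · norm_num [E, WeierstrassCurve.Δ, WeierstrassCurve.b₂, WeierstrassCurve.b₄,
      WeierstrassCurve.b₆, WeierstrassCurve.b₈]

/-- The point of `E` with the given coordinates. -/
def point (x y : ℚ) (h : y ^ 2 = x * (x - 8) * (x - 9)) : E.toAffine.Point :=
  .some x y (nonsingular_iff_equation.mpr h)

/-- A generator of the torsion of order `4`. -/
def P : E.toAffine.Point := point 12 12 (by norm_num)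

/-- A point of order `2` which is not a multiple of `P`. -/
def Q : E.toAffine.Point := point 0 0 (by norm_num)

theorem point_add_of_ne {x₁ y₁ x₂ y₂ x₃ y₃ : ℚ} {h₁ h₂ h₃} (hx : x₁ ≠ x₂)
    (h3 : x₃ = ((y₁ - y₂) / (x₁ - x₂)) ^ 2 + 17 - x₁ - x₂)
    (h4 : y₃ = -((y₁ - y₂) / (x₁ - x₂) * (x₃ - x₁) + y₁)) :
    point x₁ y₁ h₁ + point x₂ y₂ h₂ = point x₃ y₃ h₃ := by
  unfold point
  rw [Point.add_of_X_ne hx, Point.some.injEq]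
  have hX : E.toAffine.addX x₁ x₂ (E.toAffine.slope x₁ x₂ y₁ y₂) = x₃ := by
    rw [slope_of_X_ne hx, h3]
    simp only [addX, E]
    ring
  refine ⟨hX, ?_⟩
  rw [addY, negAddY, hX, slope_of_X_ne hx, h4]
  simp only [negY, E]
  ring

theorem P_add_P : P + P = point 9 0 (by norm_num) := by
  have hy : (12 : ℚ) ≠ E.toAffine.negY 12 12 := by norm_num [negY, E]
  unfold P point
  rw [Point.add_self_of_Y_ne hy, Point.some.injEq]
  rw [addY, negAddY, slope_of_Y_ne rfl hy]
  norm_num [negY, addX, E]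

theorem point_add_self_of_eq_zero {x : ℚ} {h} : point x 0 h + point x 0 h = 0 :=
  Point.add_self_of_Y_eq (by simp [negY, E])

theorem point_ne_zero {x y : ℚ} {h} : point x y h ≠ 0 := Point.some_ne_zero _

theorem eq_zero_or_eq_point (R : E.toAffine.Point) :
    R = 0 ∨ R = point 0 0 (by norm_num) ∨ R = point 8 0 (by norm_num) ∨
      R = point 9 0 (by norm_num) ∨ R = point 12 12 (by norm_num) ∨
      R = point 12 (-12) (by norm_num) ∨ R = point 6 6 (by norm_num) ∨
      R = point 6 (-6) (by norm_num) := by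
  rcases R with _ | ⟨x, y, h⟩
  · exact .inl rfl
  have he := nonsingular_iff_equation.mp h
  simp only [point, Point.some.injEq, Point.some_ne_zero, false_or]
  rcases x_eq_of_equation (x := x - 9) (y := y) (by rw [he]; ring) with hx | hx | hx | hx | hx
  · obtain rfl : x = 9 := by linarith
    have : y = 0 := by simpa using he
    simp [this]
  · obtain rfl : x = 8 := by linarith
    have : y = 0 := by simpa using he
    simp [this]
  · obtain rfl : x = 0 := by linarith
    have : y = 0 := by simpa using he
    simp [this]
  · obtain rfl : x = 12 := by linarith
    have : y = 12 ∨ y = -12 := sq_eq_sq_iff_eq_or_eq_neg.mp (by rw [he]; norm_num)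
    rcases this with rfl | rfl <;> simp
  · obtain rfl : x = 6 := by linarith
    have : y = 6 ∨ y = -6 := sq_eq_sq_iff_eq_or_eq_neg.mp (by rw [he]; norm_num)
    rcases this with rfl | rfl <;> simp

theorem two_zsmul_Q : zmultiplesHom E.toAffine.Point Q (2 : ℕ) = 0 := by
  rw [zmultiplesHom_apply, natCast_zsmul, two_nsmul]
  exact point_add_self_of_eq_zero

theorem four_zsmul_P : zmultiplesHom E.toAffine.Point P (4 : ℕ) = 0 := by
  rw [zmultiplesHom_apply, natCast_zsmul, show 4 = 2 * 2 from rfl, mul_nsmul, two_nsmul P,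
    P_add_P, two_nsmul]
  exact point_add_self_of_eq_zero

/-- The homomorphism `(a, b) ↦ a • Q + b • P`. -/
noncomputable def hom : ZMod 2 × ZMod 4 →+ E.toAffine.Point :=
  .coprod (ZMod.lift 2 ⟨zmultiplesHom _ Q, two_zsmul_Q⟩)
    (ZMod.lift 4 ⟨zmultiplesHom _ P, four_zsmul_P⟩)

theorem hom_one_zero : hom (1, 0) = point 0 0 (by norm_num) := by
  have := ZMod.lift_coe 2 ⟨zmultiplesHom _ Q, two_zsmul_Q⟩ 1
  rw [Int.cast_one] at this
  rw [hom, AddMonoidHom.coprod_apply, map_zero, add_zero, this]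
  exact one_zsmul Q

theorem hom_zero_one : hom (0, 1) = point 12 12 (by norm_num) := by
  have := ZMod.lift_coe 4 ⟨zmultiplesHom _ P, four_zsmul_P⟩ 1
  rw [Int.cast_one] at this
  rw [hom, AddMonoidHom.coprod_apply, map_zero, zero_add, this]
  exact one_zsmul P

theorem hom_zero_two : hom (0, 2) = point 9 0 (by norm_num) := by
  rw [show ((0, 2) : ZMod 2 × ZMod 4) = (0, 1) + (0, 1) from rfl, map_add, hom_zero_one]
  exact P_add_P

theorem hom_zero_three : hom (0, 3) = point 12 (-12) (by norm_num) := by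
  rw [show ((0, 3) : ZMod 2 × ZMod 4) = (0, 2) + (0, 1) from rfl, map_add, hom_zero_one,
    hom_zero_two]
  apply point_add_of_ne <;> norm_num

theorem hom_one_one : hom (1, 1) = point 6 (-6) (by norm_num) := by
  rw [show ((1, 1) : ZMod 2 × ZMod 4) = (1, 0) + (0, 1) from rfl, map_add, hom_one_zero,
    hom_zero_one]
  apply point_add_of_ne <;> norm_num

theorem hom_one_two : hom (1, 2) = point 8 0 (by norm_num) := by
  rw [show ((1, 2) : ZMod 2 × ZMod 4) = (1, 0) + (0, 2) from rfl, map_add, hom_one_zero,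
    hom_zero_two]
  apply point_add_of_ne <;> norm_num

theorem hom_one_three : hom (1, 3) = point 6 6 (by norm_num) := by
  rw [show ((1, 3) : ZMod 2 × ZMod 4) = (1, 0) + (0, 3) from rfl, map_add, hom_one_zero,
    hom_zero_three]
  apply point_add_of_ne <;> norm_num

theorem hom_injective : Function.Injective hom := by
  rw [injective_iff_map_eq_zero]
  rintro ⟨a, b⟩ h
  fin_cases a <;> fin_cases b
  · rfl
  · exact absurd (hom_zero_one.symm.trans h) point_ne_zero
  · exact absurd (hom_zero_two.symm.trans h) point_ne_zero
  · exact absurd (hom_zero_three.symm.trans h) point_ne_zero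
  · exact absurd (hom_one_zero.symm.trans h) point_ne_zero
  · exact absurd (hom_one_one.symm.trans h) point_ne_zero
  · exact absurd (hom_one_two.symm.trans h) point_ne_zero
  · exact absurd (hom_one_three.symm.trans h) point_ne_zero

theorem hom_surjective : Function.Surjective hom := by
  intro R
  rcases eq_zero_or_eq_point R with rfl | rfl | rfl | rfl | rfl | rfl | rfl | rfl
  · exact ⟨0, map_zero _⟩
  · exact ⟨_, hom_one_zero⟩
  · exact ⟨_, hom_one_two⟩
  · exact ⟨_, hom_zero_two⟩
  · exact ⟨_, hom_zero_one⟩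
  · exact ⟨_, hom_zero_three⟩
  · exact ⟨_, hom_one_three⟩
  · exact ⟨_, hom_one_one⟩

end E

/-- `E(ℚ) ≅ ℤ/2ℤ ⊕ ℤ/4ℤ` as abelian groups. -/
theorem stmt_5 : Nonempty (E.toAffine.Point ≃+ ZMod 2 × ZMod 4) := by
  exact ⟨(AddEquiv.ofBijective E.hom ⟨E.hom_injective, E.hom_surjective⟩).symm⟩
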